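/- Corollary of row decomposition: for any Young diagram Y, T(Y) = T(Y'_r) + T(A_{C_{b−1}}) · T(B_{C_{b−1}}), where Y'_r is Y with the rightmost bottom cell deleted, and C_{b−1} is the bottom cell immediately left of the rightmost bottom cell. -/

import Mathlib

/-- A Young diagram of size `n` (coordinates from the bottom-left, as in the paper):
`b i` is the length of the `i`-th row counted from the bottom, for `i < n`.
Rows get longer going up (top row is the largest), the staircase
`Y(n, n-1, ..., 1)` is contained (`i < b i`), and there are `n` columns (`b i ≤ n`). -/
def IsYoungShape (n : ℕ) (b : ℕ → ℕ) : Prop :=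
  (∀ i j : ℕ, i ≤ j → j < n → b i ≤ b j) ∧ ∀ i : ℕ, i < n → i < b i ∧ b i ≤ n

/-- A transversal of the shape `b`, encoded as a permutation sending each column `i`
(from the left) to the row `π i` (from the bottom) of the unique 1 in that column:
every cell `(column i, row π i)` must lie inside the diagram. -/
def IsTransversal (n : ℕ) (b : ℕ → ℕ) (π : Equiv.Perm (Fin n)) : Prop :=
  ∀ i : Fin n, (i : ℕ) < b (π i)

/-- The transversal `π` of the shape `b` contains the pattern `τ`: some `k` of its 1's
form a submatrix of the diagram (all crossing cells inside the diagram) identical to the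
permutation matrix of `τ`. -/
def ShapeContains (n : ℕ) (b : ℕ → ℕ) {k : ℕ} (π : Fin n → Fin n) (τ : Fin k → Fin k) : Prop :=
  ∃ f : Fin k ↪o Fin n,
    (∀ a c : Fin k, τ a < τ c ↔ π (f a) < π (f c)) ∧
    ∀ a c : Fin k, (f a : ℕ) < b (π (f c))

/-- The number of transversals of the shape `b` avoiding the pattern `τ`,
i.e. `|S_Y(τ)|`. -/
noncomputable def shapeAvoidCard (n : ℕ) (b : ℕ → ℕ) {k : ℕ} (τ : Fin k → Fin k) : ℕ :=
  Nat.card {π : Equiv.Perm (Fin n) // IsTransversal n b π ∧ ¬ ShapeContains n b ⇑π τ}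

/-- Shape-Wilf-equivalence: equally many avoiders on every Young diagram. -/
def ShapeWilfEquiv {k l : ℕ} (τ : Fin k → Fin k) (σ : Fin l → Fin l) : Prop :=
  ∀ (n : ℕ) (b : ℕ → ℕ), IsYoungShape n b → shapeAvoidCard n b τ = shapeAvoidCard n b σ

/-- `T Y`: the number of 213-avoiding transversals of the Young diagram `Y`
(the pattern 213 written 0-indexed is `![1,0,2]`). -/
noncomputable def T (n : ℕ) (b : ℕ → ℕ) : ℕ :=
  shapeAvoidCard n b (![1,0,2] : Fin 3 → Fin 3)

/-- The size `k` of the subdiagram `A_C` associated to the bottom cell `C` in column `c`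
(0-indexed) of the Young diagram `b` of size `n`: the 45° ray drawn north-east from the
top-right corner of `C` in the reduction `Y/C` first meets the border of `Y/C` after
passing through `k` cells.  (`k = 0`, i.e. `A_C = ∅`, exactly when the first diagonal
cell is already missing.) -/
noncomputable def rdK (n : ℕ) (b : ℕ → ℕ) (c : ℕ) : ℕ :=
  sInf {s : ℕ | (s = 0 ∧ (n ≤ 1 ∨ b 1 ≤ c + 1)) ∨ (1 ≤ s ∧ b s ≤ c + s + 1)}

/-- The row lengths (from the bottom) of the Young diagram `A_C` for the bottom cell in
column `c`: it occupies rows `1..k` of `Y` and the `k` columns `c+1, ..., c+k`. -/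
noncomputable def rdA (n : ℕ) (b : ℕ → ℕ) (c : ℕ) (t : ℕ) : ℕ :=
  min (rdK n b c) (b (t + 1) - (c + 1))

/-- The row lengths (from the bottom) of the Young diagram `B_C` for the bottom cell in
column `c`: what remains of `Y/C` after deleting the rows and columns of `A_C`;
it has size `n - 1 - k`. -/
noncomputable def rdB (n : ℕ) (b : ℕ → ℕ) (c : ℕ) (r : ℕ) : ℕ :=
  b (rdK n b c + 1 + r) - 1 - rdK n b c

/-- Column-row form of 213-avoidance: `π` is a transversal of `b`, and no `i < l < j` carry the
pattern 213 with the cell in the column of the `3` and the row of the `1` inside the shape. -/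
def IsAvoider (n : ℕ) (b : ℕ → ℕ) (π : Equiv.Perm (Fin n)) : Prop :=
  IsTransversal n b π ∧ ∀ i l j : Fin n, i < l → l < j → π l < π i → π i < π j →
    ¬ (j : ℕ) < b (π l)

open scoped Classical in
/-- The finite set of 213-avoiding transversals. -/
noncomputable def avoiders (n : ℕ) (b : ℕ → ℕ) : Finset (Equiv.Perm (Fin n)) :=
  Finset.univ.filter (IsAvoider n b)

theorem mem_avoiders {n : ℕ} {b : ℕ → ℕ} {π : Equiv.Perm (Fin n)} :
    π ∈ avoiders n b ↔ IsAvoider n b π := by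
  simp [avoiders]

theorem shapeContains_213_iff {n : ℕ} {b : ℕ → ℕ} (hb : ∀ i j, i ≤ j → j < n → b i ≤ b j)
    (π : Equiv.Perm (Fin n)) :
    ShapeContains n b ⇑π (![1,0,2] : Fin 3 → Fin 3) ↔
      ∃ i l j : Fin n, i < l ∧ l < j ∧ π l < π i ∧ π i < π j ∧ (j : ℕ) < b (π l) := by
  constructor
  · rintro ⟨f, h, hc⟩
    exact ⟨f 0, f 1, f 2, f.lt_iff_lt.2 (by decide), f.lt_iff_lt.2 (by decide),
      (h 1 0).1 (by decide), (h 0 2).1 (by decide), hc 2 1⟩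
  · rintro ⟨i, l, j, hil, hlj, h1, h2, h3⟩
    have hi := hb (π l) (π i) h1.le (π i).2
    have hj := hb (π l) (π j) (h1.trans h2).le (π j).2
    have hf : StrictMono (![i, l, j] : Fin 3 → Fin n) := by
      intro x y hxy
      fin_cases x <;> fin_cases y <;> simp_all
      exact hil.trans hlj
    refine ⟨OrderEmbedding.ofStrictMono _ hf, ?_, ?_⟩
    · intro x y
      fin_cases x <;> fin_cases y <;>
        simp [h1, h2, h1.le, h2.le, h1.trans h2, (h1.trans h2).le]
    · intro x y
      fin_cases x <;> fin_cases y <;> simp <;> omega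

theorem T_eq_card_avoiders {n : ℕ} {b : ℕ → ℕ} (hb : ∀ i j, i ≤ j → j < n → b i ≤ b j) :
    T n b = (avoiders n b).card := by
  rw [T, shapeAvoidCard]
  refine Nat.subtype_card _ fun π => ?_
  rw [mem_avoiders, IsAvoider, shapeContains_213_iff hb]
  push Not
  rfl

/-- Deleting the last bottom cell does not affect the avoiders whose bottom `1` is in neither of
the last two bottom cells. -/
theorem isAvoider_deleteCell_iff {n : ℕ} {b b' : ℕ → ℕ} {p q : Fin n}
    (hb : ∀ i j, i ≤ j → j < n → b i ≤ b j) (hq : (q : ℕ) = p + 1) (hm : b 0 = p + 2)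
    (h0 : b' 0 = p + 1) (hb' : ∀ i, i ≠ 0 → b' i = b i)
    (π : Equiv.Perm (Fin n)) (hp : (π p : ℕ) ≠ 0) :
    IsAvoider n b' π ↔ IsAvoider n b π ∧ (π q : ℕ) ≠ 0 := by
  constructor
  · rintro ⟨h1, h2⟩
    have hq0 : (π q : ℕ) ≠ 0 := by
      intro h
      have := h1 q
      rw [h] at this
      omega
    refine ⟨⟨?_, ?_⟩, hq0⟩
    · intro i
      have := h1 i
      by_cases h : (π i : ℕ) = 0
      · rw [h] at this ⊢; omega
      · rwa [← hb' _ h]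
    · intro i l j hil hlj h3 h4 h5
      by_cases h : (π l : ℕ) = 0
      · by_cases hj : j = q
        · have hlp : l ≠ p := by
            rintro rfl
            exact hp h
          have hl' : l < p := by omega
          have hip : π i ≠ π p := fun h => (hil.trans hl').ne (π.injective h)
          rcases lt_or_gt_of_ne hip with h6 | h6
          · refine h2 i l p hil hl' h3 h6 ?_
            rw [h]; omega
          · refine h2 i p j (hil.trans hl') (by omega) h6 h4 ?_
            have := hb 0 (π p) (by omega) (π p).2
            rw [hb' _ hp]
            omega
        · refine h2 i l j hil hlj h3 h4 ?_
          rw [h] at h5 ⊢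
          omega
      · refine h2 i l j hil hlj h3 h4 ?_
        rwa [hb' _ h]
  · rintro ⟨⟨h1, h2⟩, hq0⟩
    refine ⟨?_, ?_⟩
    · intro i
      have h3 := h1 i
      by_cases h : (π i : ℕ) = 0
      · have hi : i ≠ q := by
          rintro rfl
          exact hq0 h
        rw [h] at h3 ⊢
        omega
      · rwa [hb' _ h]
    · intro i l j hil hlj h3 h4 h5
      refine h2 i l j hil hlj h3 h4 ?_
      by_cases h : (π l : ℕ) = 0
      · rw [h] at h5 ⊢; omega
      · rwa [← hb' _ h]

/-- Moving a bottom `1` from the last bottom cell one column to the left, after deleting the last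
bottom cell. -/
theorem isAvoider_mul_swap_iff {n : ℕ} {b b' : ℕ → ℕ} {p q : Fin n}
    (hb : ∀ i j, i ≤ j → j < n → b i ≤ b j) (hq : (q : ℕ) = p + 1) (hm : b 0 = p + 2)
    (h0 : b' 0 = p + 1) (hb' : ∀ i, i ≠ 0 → b' i = b i)
    (π : Equiv.Perm (Fin n)) (hq0 : (π q : ℕ) = 0) :
    IsAvoider n b' (π * Equiv.swap p q) ↔ IsAvoider n b π := by
  set s := Equiv.swap p q with hs
  have hsv : ∀ i : Fin n, (i = p ∧ s i = q) ∨ (i = q ∧ s i = p) ∨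
      (i ≠ p ∧ i ≠ q ∧ s i = i) := by
    intro i
    by_cases h1 : i = p
    · left; simp [h1, hs]
    · by_cases h2 : i = q
      · right; left; simp [h2, hs]
      · exact Or.inr (Or.inr ⟨h1, h2, Equiv.swap_apply_of_ne_of_ne h1 h2⟩)
  have hss : ∀ i, s (s i) = i := fun i => Equiv.swap_apply_self p q i
  have hz : ∀ i, (π i : ℕ) = 0 → i = q := fun i h => π.injective (Fin.ext (h.trans hq0.symm))
  have hbig : ∀ i, p + 2 ≤ b (π i) := fun i => hm ▸ hb 0 (π i) (Nat.zero_le _) (π i).2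
  have hmono : ∀ i j, i ≠ q → j ≠ q → i < j → s i < s j := by
    intro i j hi hj hij
    have := hsv i
    have := hsv j
    omega
  have hmono' : ∀ i j, i ≠ p → j ≠ p → i < j → s i < s j := by
    intro i j hi hj hij
    have := hsv i
    have := hsv j
    omega
  have hlt : ∀ j k, ((s j : ℕ) < b (π k) ↔ (j : ℕ) < b (π k)) := by
    intro j k
    have := hbig k
    have := hsv j
    omega
  constructor
  · rintro ⟨h1, h2⟩
    refine ⟨fun i => ?_, fun i l j hil hlj h3 h4 h5 => ?_⟩
    · by_cases h : (π i : ℕ) = 0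
      · rw [h, hz i h]; omega
      · have := h1 (s i)
        rwa [Equiv.Perm.mul_apply, hss, hb' _ h, hlt] at this
    · by_cases h : (π l : ℕ) = 0
      · rw [h] at h5
        have := hz l h
        omega
      · have hne : ∀ x, (π x : ℕ) ≠ 0 → x ≠ q := fun x hx h => hx (h ▸ hq0)
        refine h2 (s i) (s l) (s j) (hmono _ _ (hne _ ?_) (hne _ h) hil)
          (hmono _ _ (hne _ h) (hne _ ?_) hlj) ?_ ?_ ?_
        · omega
        · omega
        · simpa [hss] using h3
        · simpa [hss] using h4
        · rwa [Equiv.Perm.mul_apply, hss, hb' _ h, hlt]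
  · rintro ⟨h1, h2⟩
    have hz' : ∀ i, (π (s i) : ℕ) = 0 → i = p := by
      intro i h
      have := hz _ h
      have := hsv i
      omega
    have hne : ∀ x, (π (s x) : ℕ) ≠ 0 → x ≠ p := by
      rintro x hx rfl
      simp [hs, hq0] at hx
    refine ⟨fun i => ?_, fun i l j hil hlj h3 h4 h5 => ?_⟩
    · rw [Equiv.Perm.mul_apply]
      by_cases h : (π (s i) : ℕ) = 0
      · rw [h, hz' i h]; omega
      · rw [hb' _ h, ← hlt]
        exact h1 (s i)
    · rw [Equiv.Perm.mul_apply] at h3 h4 h5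
      rw [Equiv.Perm.mul_apply] at h3 h4
      by_cases h : (π (s l) : ℕ) = 0
      · rw [h] at h5
        have := hz' l h
        omega
      · refine h2 (s i) (s l) (s j) (hmono' _ _ (hne _ ?_) (hne _ h) hil)
          (hmono' _ _ (hne _ h) (hne _ ?_) hlj) h3 h4 ?_
        · omega
        · omega
        · rwa [hb' _ h, ← hlt] at h5

open scoped Classical in
/-- The avoiders of a shape, minus those of the shape without its last bottom cell, are counted by
the avoiders whose bottom `1` is next to the last bottom cell. -/
theorem card_avoiders_deleteCell {n : ℕ} {b b' : ℕ → ℕ} {p q : Fin n}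
    (hb : ∀ i j, i ≤ j → j < n → b i ≤ b j) (hq : (q : ℕ) = p + 1) (hm : b 0 = p + 2)
    (h0 : b' 0 = p + 1) (hb' : ∀ i, i ≠ 0 → b' i = b i) :
    (avoiders n b).card =
      (avoiders n b').card + ((avoiders n b).filter fun π => (π p : ℕ) = 0).card := by
  have hpq : p ≠ q := by omega
  rw [← Finset.card_filter_add_card_filter_not (s := avoiders n b) fun π => (π p : ℕ) = 0,
    ← Finset.card_filter_add_card_filter_not (s := avoiders n b') fun π => (π p : ℕ) = 0,
    ← Finset.card_filter_add_card_filter_not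
      (s := (avoiders n b).filter fun π => ¬ (π p : ℕ) = 0) fun π => (π q : ℕ) = 0]
  have h1 : ((avoiders n b).filter fun π => ¬ (π p : ℕ) = 0).filter (fun π => ¬ (π q : ℕ) = 0) =
      (avoiders n b').filter fun π => ¬ (π p : ℕ) = 0 := by
    ext π
    simp only [Finset.mem_filter, mem_avoiders]
    constructor
    · rintro ⟨⟨h1, h2⟩, h3⟩
      exact ⟨(isAvoider_deleteCell_iff hb hq hm h0 hb' π h2).2 ⟨h1, h3⟩, h2⟩
    · rintro ⟨h1, h2⟩
      obtain ⟨h3, h4⟩ := (isAvoider_deleteCell_iff hb hq hm h0 hb' π h2).1 h1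
      exact ⟨⟨h3, h2⟩, h4⟩
  have h2 : (((avoiders n b).filter fun π => ¬ (π p : ℕ) = 0).filter
      fun π => (π q : ℕ) = 0).card = ((avoiders n b').filter fun π => (π p : ℕ) = 0).card := by
    refine Finset.card_bij' (fun π _ => π * Equiv.swap p q) (fun π _ => π * Equiv.swap p q)
      ?_ ?_ (fun π _ => by simp [mul_assoc]) (fun π _ => by simp [mul_assoc])
    · intro π hπ
      simp only [Finset.mem_filter, mem_avoiders] at hπ ⊢
      exact ⟨(isAvoider_mul_swap_iff hb hq hm h0 hb' π hπ.2).2 hπ.1.1, by simpa using hπ.2⟩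
    · intro π hπ
      simp only [Finset.mem_filter, mem_avoiders] at hπ ⊢
      have hq0 : ((π * Equiv.swap p q) q : ℕ) = 0 := by simpa using hπ.2
      refine ⟨⟨(isAvoider_mul_swap_iff hb hq hm h0 hb' _ hq0).1 (by simpa [mul_assoc] using hπ.1),
        fun h => hpq ?_⟩, hq0⟩
      exact (π * Equiv.swap p q).injective (Fin.ext (h.trans hq0.symm))
  rw [h1, h2]
  ring

/-- Avoiders whose bottom `1` lies next to the last bottom cell put the `1`s of all columns to
its left above the rows of the diagonal block. -/
theorem IsAvoider.lt_of_lt {n : ℕ} {b : ℕ → ℕ} {k : ℕ} {c q : Fin n}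
    (hY : IsYoungShape n b) (hc : b 0 = c + 2) (hq : (q : ℕ) = c + 1)
    (hdiag : ∀ s, 1 ≤ s → s < k → (c : ℕ) + s + 2 ≤ b s)
    {π : Equiv.Perm (Fin n)} (hπ : IsAvoider n b π) (h0 : (π c : ℕ) = 0)
    (i : Fin n) (hi : i < c) : k < (π i : ℕ) := by
  by_contra hcon
  obtain ⟨-, h2⟩ := hπ
  have hne : ∀ j : Fin n, c < j → π j ≠ π i := by
    intro j hj h
    have := π.injective h
    omega
  have hpos : ∀ j : Fin n, c < j → 1 ≤ (π j : ℕ) := by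
    intro j hj
    by_contra h
    exact hj.ne' (π.injective (Fin.ext (by omega)))
  have pigeon : ∀ m (hm : (c : ℕ) + m < n), 1 ≤ m →
      ∃ l : Fin n, c < l ∧ (l : ℕ) ≤ c + m ∧ m ≤ (π l : ℕ) := by
    intro m hm hm1
    by_contra! h
    have hcard := Fintype.card_le_of_injective
      (fun x : Fin m => (⟨(π ⟨c + 1 + x, by omega⟩ : ℕ) - 1, by
        have := h ⟨c + 1 + x, by omega⟩ (by rw [Fin.lt_def]; simp; omega) (by simp; omega)
        have := hpos ⟨c + 1 + x, by omega⟩ (by rw [Fin.lt_def]; simp; omega)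
        omega⟩ : Fin (m - 1))) (by
        intro x y hxy
        have hx := hpos ⟨c + 1 + x, by omega⟩ (by rw [Fin.lt_def]; simp; omega)
        have hy := hpos ⟨c + 1 + y, by omega⟩ (by rw [Fin.lt_def]; simp; omega)
        simp only [Fin.mk.injEq] at hxy
        have := congrArg Fin.val (π.injective (Fin.ext (by omega) :
          π ⟨c + 1 + x, by omega⟩ = π ⟨c + 1 + y, by omega⟩))
        simp at this
        exact Fin.ext this)
    simp at hcard
    omega
  have hr : ∀ m, 1 ≤ m → m ≤ (π i : ℕ) → (c : ℕ) + m < n ∧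
      ∀ l : Fin n, c < l → (l : ℕ) ≤ c + m → π l < π i := by
    intro m hm
    induction m, hm using Nat.le_induction with
    | base =>
      intro _
      refine ⟨by omega, fun l hl hl' => lt_of_le_of_ne ?_ (hne l hl)⟩
      by_contra! h
      refine h2 i c l hi hl ?_ h ?_
      · omega
      · rw [h0]; omega
    | succ m hm ih =>
      intro hmi
      obtain ⟨hmn, ih⟩ := ih (by omega)
      obtain ⟨l, hl1, hl2, hl3⟩ := pigeon m hmn hm
      have hbm := hdiag m hm (by omega)
      have hbn := (hY.2 m (by omega)).2
      have hbl := hY.1 m (π l) hl3 (π l).2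
      refine ⟨by omega, fun j hj hj' => ?_⟩
      by_cases hjm : (j : ℕ) ≤ c + m
      · exact ih j hj hjm
      · refine lt_of_le_of_ne ?_ (hne j hj)
        by_contra! h
        exact h2 i l j (by omega) (by omega) (ih l hl1 hl2) h (by omega)
  have hi1 : 1 ≤ (π i : ℕ) := by
    by_contra h
    exact hi.ne (π.injective (Fin.ext (by omega)))
  obtain ⟨hn', hl⟩ := hr _ hi1 le_rfl
  obtain ⟨l, hl1, hl2, hl3⟩ := pigeon _ hn' hi1
  have := Fin.lt_def.1 (hl l hl1 hl2)
  omega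

/-- Splits `n` positions into the position `c`, the block of the `k` positions following it, and
the remaining positions in increasing order. -/
noncomputable def blockEquiv (n k c : ℕ) (h : c + k < n) :
    Unit ⊕ (Fin k ⊕ Fin (n - 1 - k)) ≃ Fin n :=
  Equiv.ofBijective
    (Sum.elim (fun _ => ⟨c, by omega⟩)
      (Sum.elim (fun x => ⟨c + 1 + x, by omega⟩)
        (fun y => ⟨if (y : ℕ) < c then y else y + k + 1, by split_ifs <;> omega⟩))) <| by
    rw [Fintype.bijective_iff_injective_and_card]
    constructor
    · rintro (x | x | x) (y | y | y) hxy <;> simp [Fin.ext_iff] at hxy ⊢ <;>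
        (try split_ifs at hxy) <;> omega
    · simp
      omega

theorem blockEquiv_inl {n k c : ℕ} (h : c + k < n) (x : Unit) :
    (blockEquiv n k c h (Sum.inl x) : ℕ) = c := rfl

theorem blockEquiv_inr_inl {n k c : ℕ} (h : c + k < n) (x : Fin k) :
    (blockEquiv n k c h (Sum.inr (Sum.inl x)) : ℕ) = c + 1 + x := rfl

theorem blockEquiv_inr_inr {n k c : ℕ} (h : c + k < n) (y : Fin (n - 1 - k)) :
    (blockEquiv n k c h (Sum.inr (Sum.inr y)) : ℕ) = if (y : ℕ) < c then (y : ℕ) else y + k + 1 :=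
  rfl

/-- Assembles a permutation of `n` from a bottom `1` in column `c`, a permutation of the block of
size `k` north-east of it, and a permutation of the remaining rows and columns. -/
noncomputable def blockPerm (n k c : ℕ) (h : c + k < n) (α : Equiv.Perm (Fin k))
    (β : Equiv.Perm (Fin (n - 1 - k))) : Equiv.Perm (Fin n) :=
  (blockEquiv n k c h).symm.trans
    ((Equiv.sumCongr (Equiv.refl Unit) (Equiv.sumCongr α β)).trans
      (blockEquiv n k 0 (by omega)))

section blockPerm

variable {n k c : ℕ} (h : c + k < n) (α : Equiv.Perm (Fin k)) (β : Equiv.Perm (Fin (n - 1 - k)))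

theorem blockPerm_inl (x : Unit) :
    (blockPerm n k c h α β (blockEquiv n k c h (Sum.inl x)) : ℕ) = 0 := by
  simp [blockPerm, blockEquiv_inl]

theorem blockPerm_inr_inl (x : Fin k) :
    (blockPerm n k c h α β (blockEquiv n k c h (Sum.inr (Sum.inl x))) : ℕ) = 1 + α x := by
  simp [blockPerm, blockEquiv_inr_inl]

theorem blockPerm_inr_inr (y : Fin (n - 1 - k)) :
    (blockPerm n k c h α β (blockEquiv n k c h (Sum.inr (Sum.inr y))) : ℕ) = k + 1 + β y := by
  simp [blockPerm, blockEquiv_inr_inr]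
  omega

variable {b : ℕ → ℕ}

theorem isAvoider_blockPerm_iff (hb : ∀ i j, i ≤ j → j < n → b i ≤ b j) (hc : b 0 = c + 2)
    (hk : 1 ≤ k) (hbk : b k = c + k + 1) :
    IsAvoider n b (blockPerm n k c h α β) ↔
      IsAvoider k (fun t => min k (b (t + 1) - (c + 1))) α ∧
        IsAvoider (n - 1 - k) (fun r => b (k + 1 + r) - 1 - k) β := by
  set e := blockEquiv n k c h with he
  have e0 : ∀ x, (e (Sum.inl x) : ℕ) = c := blockEquiv_inl h
  have e1 : ∀ x, (e (Sum.inr (Sum.inl x)) : ℕ) = c + 1 + x := blockEquiv_inr_inl h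
  have e2 : ∀ x, (e (Sum.inr (Sum.inr x)) : ℕ) = if (x : ℕ) < c then (x : ℕ) else x + k + 1 :=
    blockEquiv_inr_inr h
  have p0 := blockPerm_inl h α β
  have p1 := blockPerm_inr_inl h α β
  have p2 := blockPerm_inr_inr h α β
  set π := blockPerm n k c h α β
  rw [← he] at p0 p1 p2
  have hbA : ∀ x : Fin k, c + 2 ≤ b (1 + x) ∧ b (1 + x) ≤ c + k + 1 := fun x =>
    ⟨hc ▸ hb 0 _ (by omega) (by omega), hbk ▸ hb _ k (by omega) (by omega)⟩
  have hbB : ∀ x : Fin (n - 1 - k), c + k + 1 ≤ b (k + 1 + x) := fun x =>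
    hbk ▸ hb k _ (by omega) (by omega)
  constructor
  · rintro ⟨h1, h2⟩
    refine ⟨⟨fun x => ?_, fun i l j hil hlj h3 h4 h5 => ?_⟩,
      ⟨fun x => ?_, fun i l j hil hlj h3 h4 h5 => ?_⟩⟩
    · have := h1 (e (Sum.inr (Sum.inl x)))
      rw [e1, p1, add_comm 1] at this
      have := x.2
      simp only
      omega
    · refine h2 (e (Sum.inr (Sum.inl i))) (e (Sum.inr (Sum.inl l))) (e (Sum.inr (Sum.inl j)))
        ?_ ?_ ?_ ?_ ?_
      · rw [Fin.lt_def, e1, e1]; omega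
      · rw [Fin.lt_def, e1, e1]; omega
      · rw [Fin.lt_def, p1, p1]; omega
      · rw [Fin.lt_def, p1, p1]; omega
      · rw [e1, p1, add_comm 1 (α l : ℕ)]
        simp only at h5
        omega
    · have := h1 (e (Sum.inr (Sum.inr x)))
      have := hbB (β x)
      rw [e2, p2] at *
      simp only
      split_ifs at * <;> omega
    · have := hbB (β l)
      refine h2 (e (Sum.inr (Sum.inr i))) (e (Sum.inr (Sum.inr l))) (e (Sum.inr (Sum.inr j)))
        ?_ ?_ ?_ ?_ ?_
      · rw [Fin.lt_def, e2, e2]; split_ifs <;> omega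
      · rw [Fin.lt_def, e2, e2]; split_ifs <;> omega
      · rw [Fin.lt_def, p2, p2]; omega
      · rw [Fin.lt_def, p2, p2]; omega
      · rw [e2, p2]
        simp only at h5
        split_ifs <;> omega
  · rintro ⟨⟨hA1, hA2⟩, ⟨hB1, hB2⟩⟩
    constructor
    · intro i
      obtain ⟨i, rfl⟩ := e.surjective i
      rcases i with i | i | i
      · rw [e0, p0]; omega
      · have := hA1 i
        rw [e1, p1, add_comm 1 (α i : ℕ)]
        simp only at this
        omega
      · have := hB1 i
        have := hbB (β i)
        rw [e2, p2]
        simp only at *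
        split_ifs <;> omega
    · intro i l j hil hlj h3 h4 h5
      obtain ⟨i, rfl⟩ := e.surjective i
      obtain ⟨l, rfl⟩ := e.surjective l
      obtain ⟨j, rfl⟩ := e.surjective j
      rw [Fin.lt_def] at hil hlj h3 h4
      rcases l with l | l | l
      · rw [e0] at hil hlj
        rw [p0, hc] at h5
        rcases j with j | j | j
        · rw [p0] at h4; omega
        · rw [p1] at h4
          rcases i with i | i | i
          · rw [p0] at h3; omega
          · rw [e1] at hil; omega
          · rw [p2] at h4; omega
        · rw [e2] at hlj h5
          split_ifs at * <;> omega
      · rw [p1] at h3 h5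
        rw [e1] at hil hlj
        have := hbA (α l)
        rcases j with j | j | j
        · rw [e0] at hlj; omega
        · rw [p1] at h4
          rcases i with i | i | i
          · rw [p0] at h3; omega
          · rw [p1] at h3 h4
            rw [e1] at hil hlj h5
            refine hA2 i l j (by omega) (by omega) (by omega) (by omega) ?_
            rw [add_comm 1 (α l : ℕ)] at h5
            simp only
            omega
          · rw [p2] at h4; omega
        · rw [e2] at hlj h5
          split_ifs at * <;> omega
      · rw [p2] at h3 h5
        have := hbB (β l)
        rcases i with i | i | i
        · rw [p0] at h3; omega
        · rw [p1] at h3; omega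
        · rw [p2] at h3 h4
          rcases j with j | j | j
          · rw [p0] at h4; omega
          · rw [p1] at h4; omega
          · rw [p2] at h4
            rw [e2, e2] at hil hlj
            rw [e2] at h5
            refine hB2 i l j ?_ ?_ (by omega) (by omega) ?_
            · split_ifs at hil <;> omega
            · split_ifs at hlj <;> omega
            · simp only
              split_ifs at h5 <;> omega

theorem blockPerm_injective {α α' : Equiv.Perm (Fin k)} {β β' : Equiv.Perm (Fin (n - 1 - k))}
    (hαβ : blockPerm n k c h α β = blockPerm n k c h α' β') : α = α' ∧ β = β' := by
  constructor
  · ext x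
    have h1 := blockPerm_inr_inl h α β x
    rw [hαβ, blockPerm_inr_inl] at h1
    omega
  · ext x
    have h1 := blockPerm_inr_inr h α β x
    rw [hαβ, blockPerm_inr_inr] at h1
    omega

/-- A permutation with bottom `1` in column `c` whose rows `1, …, k` are occupied in columns
`c + 1, …, c + k` is assembled from two blocks. -/
theorem exists_blockPerm_eq {π : Equiv.Perm (Fin n)}
    (h0 : ∀ i : Fin n, (π i : ℕ) = 0 → (i : ℕ) = c)
    (hA : ∀ i : Fin n, 1 ≤ (π i : ℕ) → (π i : ℕ) ≤ k → c < (i : ℕ) ∧ (i : ℕ) ≤ c + k) :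
    ∃ α β, blockPerm n k c h α β = π := by
  have h' : 0 + k < n := by omega
  set e := blockEquiv n k c h with he
  set r := blockEquiv n k 0 h' with hr
  set σ : Equiv.Perm (Unit ⊕ (Fin k ⊕ Fin (n - 1 - k))) := r.trans (π.symm.trans e.symm) with hσ
  have hσ' : ∀ z, π (e (σ z)) = r z := fun z => by simp [hσ]
  have h1 : Set.MapsTo σ (Set.range Sum.inl) (Set.range Sum.inl) := by
    rintro _ ⟨x, rfl⟩
    have h2 : (e (σ (Sum.inl x)) : ℕ) = c := h0 _ (by rw [hσ', hr, blockEquiv_inl])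
    exact ⟨(), e.injective (Fin.ext (by rw [h2, he, blockEquiv_inl]))⟩
  obtain ⟨⟨u, τ⟩, hτ⟩ := Equiv.Perm.mem_sumCongrHom_range_of_perm_mapsTo_inl h1
  have hτ' : ∀ z, σ (Sum.inr z) = Sum.inr (τ z) := fun z => by rw [← hτ]; rfl
  have h2 : Set.MapsTo τ (Set.range Sum.inl) (Set.range Sum.inl) := by
    rintro _ ⟨x, rfl⟩
    have h3 := hσ' (Sum.inr (Sum.inl x))
    rw [hτ'] at h3
    have h4 := congrArg Fin.val h3
    rw [hr, blockEquiv_inr_inl] at h4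
    have h5 := hA (e (Sum.inr (τ (Sum.inl x)))) (by omega) (by omega)
    rcases h6 : τ (Sum.inl x) with y | y
    · exact ⟨y, rfl⟩
    · rw [h6, he, blockEquiv_inr_inr] at h5
      split_ifs at h5 <;> omega
  obtain ⟨⟨α, β⟩, hαβ⟩ := Equiv.Perm.mem_sumCongrHom_range_of_perm_mapsTo_inl h2
  refine ⟨α⁻¹, β⁻¹, ?_⟩
  have hστ : σ.symm = Equiv.sumCongr (Equiv.refl Unit) (Equiv.sumCongr α⁻¹ β⁻¹) := by
    rw [← hτ, ← hαβ]
    ext z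
    rcases z with z | z | z <;> rfl
  rw [blockPerm, ← hστ, ← he, ← hr, hσ]
  ext i
  simp

end blockPerm

open scoped Classical in
/-- Avoiders with bottom `1` next to the last bottom cell correspond to pairs of avoiders of the
diagonal block and of the remaining shape. -/
theorem card_avoiders_filter_eq_mul {n k c : ℕ} {b : ℕ → ℕ} (h : c + k < n)
    {p : Fin n} (hp : (p : ℕ) = c) (hY : IsYoungShape n b)
    (hc : b 0 = c + 2) (hk : 1 ≤ k) (hbk : b k = c + k + 1)
    (hdiag : ∀ s, 1 ≤ s → s < k → c + s + 2 ≤ b s) :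
    ((avoiders n b).filter fun π => (π p : ℕ) = 0).card =
      (avoiders k fun t => min k (b (t + 1) - (c + 1))).card *
        (avoiders (n - 1 - k) fun r => b (k + 1 + r) - 1 - k).card := by
  have hp' : p = blockEquiv n k c h (Sum.inl ()) := Fin.ext hp
  rw [← Finset.card_product]
  symm
  refine Finset.card_bij (fun x _ => blockPerm n k c h x.1 x.2) ?_ ?_ ?_
  · rintro ⟨α, β⟩ hαβ
    simp only [Finset.mem_product, Finset.mem_filter, mem_avoiders] at hαβ ⊢
    exact ⟨(isAvoider_blockPerm_iff h α β hY.1 hc hk hbk).2 hαβ, hp' ▸ blockPerm_inl h α β ()⟩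
  · rintro ⟨α, β⟩ - ⟨α', β'⟩ - hαβ
    exact Prod.ext_iff.2 (blockPerm_injective h hαβ)
  · intro π hπ
    simp only [Finset.mem_filter, mem_avoiders] at hπ
    obtain ⟨hav, h0⟩ := hπ
    have hinj : ∀ i, (π i : ℕ) = 0 → i = p := fun i hi =>
      π.injective (Fin.ext (hi.trans h0.symm))
    obtain ⟨α, β, rfl⟩ := exists_blockPerm_eq h (π := π) (fun i hi => hinj i hi ▸ hp) (by
      intro i hi hik
      have h1 := hav.1 i
      have h2 := hY.1 _ k hik (by omega)
      have h3 : i ≠ p := by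
        rintro rfl
        omega
      have h4 : ¬ i < p := fun hip => by
        have := hav.lt_of_lt (q := ⟨c + 1, by omega⟩) (k := k) hY (by omega) (by simp [hp])
          (by simpa [hp] using hdiag) h0 i hip
        omega
      omega)
    exact ⟨⟨α, β⟩, by
      simpa [mem_avoiders] using (isAvoider_blockPerm_iff h α β hY.1 hc hk hbk).1 hav, rfl⟩

/-- The diagonal block next to the last bottom cell is nonempty, and is the first one whose top
row ends on the diagonal. -/
theorem rdK_spec {n : ℕ} {b : ℕ → ℕ} {c : ℕ} (hY : IsYoungShape n b) (hc : b 0 = c + 2)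
    (hn : 1 < n) :
    1 ≤ rdK n b c ∧ rdK n b c < n ∧ b (rdK n b c) = c + rdK n b c + 1 ∧
      ∀ s, 1 ≤ s → s < rdK n b c → c + s + 2 ≤ b s := by
  have hmem : n - 1 ∈ {s : ℕ | (s = 0 ∧ (n ≤ 1 ∨ b 1 ≤ c + 1)) ∨ (1 ≤ s ∧ b s ≤ c + s + 1)} := by
    have := (hY.2 (n - 1) (by omega)).2
    exact Or.inr ⟨by omega, by omega⟩
  have hk := Nat.sInf_mem ⟨_, hmem⟩
  have hle : rdK n b c ≤ n - 1 := Nat.sInf_le hmem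
  have h1 := hY.1 0 1 (by omega) hn
  have hlt : ∀ s, 1 ≤ s → s < rdK n b c → c + s + 2 ≤ b s := by
    intro s hs hsk
    by_contra hcon
    exact Nat.notMem_of_lt_sInf hsk (Or.inr ⟨hs, by omega⟩)
  change (rdK n b c = 0 ∧ _) ∨ (1 ≤ rdK n b c ∧ b (rdK n b c) ≤ c + rdK n b c + 1) at hk
  have hk' : 1 ≤ rdK n b c ∧ b (rdK n b c) ≤ c + rdK n b c + 1 := by omega
  refine ⟨hk'.1, by omega, le_antisymm hk'.2 ?_, hlt⟩
  have h2 := hY.1 (rdK n b c - 1) (rdK n b c) (by omega) (by omega)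
  rcases Nat.lt_or_ge 1 (rdK n b c) with h3 | h3
  · have := hlt (rdK n b c - 1) (by omega) (by omega)
    omega
  · rw [show rdK n b c - 1 = 0 by omega] at h2
    omega

/-- Corollary of row decomposition: `T(Y) = T(Y'_r) + T(A_{C_{b-1}}) · T(B_{C_{b-1}})`,
where `Y'_r` deletes the rightmost bottom cell (column `b 0 - 1`) and `C_{b-1}` is the
bottom cell in column `b 0 - 2`. -/
theorem row_decomposition_corollary (n : ℕ) (b : ℕ → ℕ) (hn : 0 < n)
    (hY : IsYoungShape n b) (hm : 2 ≤ b 0) :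
    T n b = T n (fun i => if i = 0 then b 0 - 1 else b i)
      + T (rdK n b (b 0 - 2)) (rdA n b (b 0 - 2))
        * T (n - 1 - rdK n b (b 0 - 2)) (rdB n b (b 0 - 2)) := by
  obtain ⟨c, hc⟩ : ∃ c, b 0 = c + 2 := ⟨b 0 - 2, by omega⟩
  have hb0 := (hY.2 0 hn).2
  rw [show b 0 - 2 = c by omega]
  obtain ⟨hk, hkn, hbk, hdiag⟩ := rdK_spec hY hc (by omega)
  have hbn := (hY.2 _ hkn).2
  have hA : ∀ i j, i ≤ j → j < rdK n b c → rdA n b c i ≤ rdA n b c j := by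
    intro i j hij hj
    have := hY.1 (i + 1) (j + 1) (by omega) (by omega)
    unfold rdA
    omega
  have hB : ∀ i j, i ≤ j → j < n - 1 - rdK n b c → rdB n b c i ≤ rdB n b c j := by
    intro i j hij hj
    have := hY.1 (rdK n b c + 1 + i) (rdK n b c + 1 + j) (by omega) (by omega)
    unfold rdB
    omega
  have hY' : ∀ i j, i ≤ j → j < n →
      (if i = 0 then b 0 - 1 else b i) ≤ (if j = 0 then b 0 - 1 else b j) := by
    intro i j hij hj
    have := hY.1 i j hij hj
    have := hY.1 0 j (by omega) hj
    split_ifs <;> omega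
  rw [T_eq_card_avoiders hY.1, T_eq_card_avoiders hY', T_eq_card_avoiders hA,
    T_eq_card_avoiders hB,
    card_avoiders_deleteCell (b' := fun i => if i = 0 then b 0 - 1 else b i)
      (p := ⟨c, by omega⟩) (q := ⟨c + 1, by omega⟩) hY.1 rfl hc (by simp [hc])
      (fun i hi => by simp [hi]),
    card_avoiders_filter_eq_mul (h := (by omega : c + rdK n b c < n)) rfl hY hc hk hbk hdiag]
  rfl
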